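/- Let G ⊆ H be subgroups of S_n, let x ∈ A_f be a trivial G-invariant, and let T be a finite subset of H containing exactly one representative of each left coset of G in H. Then ∑_{ρ ∈ T} ρ·x is a trivial H-invariant. -/

import Mathlib

open MvPolynomial

noncomputable section

/-- The ideal defining the splitting algebra of `f = Xⁿ + a₁Xⁿ⁻¹ + ⋯ + aₙ`. -/
def splittingIdeal (A : Type*) [CommRing A] (n : ℕ) (a : Fin n → A) :
    Ideal (MvPolynomial (Fin n) A) :=
  Ideal.span (Set.range fun k : Fin n =>
    esymm (Fin n) A (k.1 + 1) - C ((-1 : A) ^ (k.1 + 1) * a k))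

/-- The splitting algebra `A_f`. -/
abbrev SplittingAlg (A : Type*) [CommRing A] (n : ℕ) (a : Fin n → A) : Type _ :=
  MvPolynomial (Fin n) A ⧸ splittingIdeal A n a

/-- The quotient map `π`. -/
def splittingMk (A : Type*) [CommRing A] (n : ℕ) (a : Fin n → A) :
    MvPolynomial (Fin n) A →ₐ[A] SplittingAlg A n a :=
  Ideal.Quotient.mkₐ A (splittingIdeal A n a)

/-- The universal roots `τᵢ`. -/
def tau (A : Type*) [CommRing A] (n : ℕ) (a : Fin n → A) (i : Fin n) :
    SplittingAlg A n a :=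
  splittingMk A n a (X i)

theorem rename_mem_splittingIdeal (A : Type*) [CommRing A] (n : ℕ) (a : Fin n → A)
    (σ : Equiv.Perm (Fin n)) {p : MvPolynomial (Fin n) A}
    (hp : p ∈ splittingIdeal A n a) :
    rename (σ : Fin n → Fin n) p ∈ splittingIdeal A n a := by
  have h : (splittingIdeal A n a).map ((rename (σ : Fin n → Fin n)).toRingHom :
      MvPolynomial (Fin n) A →+* MvPolynomial (Fin n) A) ≤ splittingIdeal A n a := by
    rw [splittingIdeal, Ideal.map_span]
    refine Ideal.span_le.2 ?_
    rintro _ ⟨_, ⟨k, rfl⟩, rfl⟩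
    have hren : (rename (σ : Fin n → Fin n))
        (esymm (Fin n) A (k.1 + 1) - C ((-1 : A) ^ (k.1 + 1) * a k))
        = esymm (Fin n) A (k.1 + 1) - C ((-1 : A) ^ (k.1 + 1) * a k) := by
      rw [map_sub, esymm_isSymmetric (Fin n) A (k.1 + 1) σ, rename_C]
    show (rename (σ : Fin n → Fin n))
        (esymm (Fin n) A (k.1 + 1) - C ((-1 : A) ^ (k.1 + 1) * a k)) ∈ _
    rw [hren]
    exact Ideal.subset_span ⟨k, rfl⟩
  exact h (Ideal.mem_map_of_mem _ hp)

/-- The action of a permutation `σ` on the splitting algebra, as an `A`-algebra map. -/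
def permHom (A : Type*) [CommRing A] (n : ℕ) (a : Fin n → A) (σ : Equiv.Perm (Fin n)) :
    SplittingAlg A n a →ₐ[A] SplittingAlg A n a :=
  Ideal.Quotient.liftₐ (splittingIdeal A n a)
    ((splittingMk A n a).comp (rename (σ : Fin n → Fin n)))
    (fun p hp => by
      have h := rename_mem_splittingIdeal A n a σ hp
      show Ideal.Quotient.mkₐ A (splittingIdeal A n a) _ = 0
      rw [Ideal.Quotient.mkₐ_eq_mk]
      exact (Ideal.Quotient.eq_zero_iff_mem).2 h)

/-- The trivial `G`-invariants of the splitting algebra. -/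
def trivialInv (A : Type*) [CommRing A] (n : ℕ) (a : Fin n → A)
    (G : Subgroup (Equiv.Perm (Fin n))) : Set (SplittingAlg A n a) :=
  splittingMk A n a '' {p | ∀ σ ∈ G, rename (σ : Fin n → Fin n) p = p}

/-- The element `D_f = ∏_{i<j} (τᵢ + τⱼ)`. -/
def Df (A : Type*) [CommRing A] (n : ℕ) (a : Fin n → A) : SplittingAlg A n a :=
  ∏ p ∈ Finset.univ.filter (fun p : Fin n × Fin n => p.1 < p.2),
    (tau A n a p.1 + tau A n a p.2)

end

/-- Left translation by an element of `H` does not change a sum over representatives of the left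
cosets of `G` in `H` of a function that is constant on left cosets of `G`. -/
theorem sum_mul_left_eq_sum_of_transversal {Γ M : Type*} [Group Γ] [AddCommMonoid M]
    {G H : Subgroup Γ} {T : Finset Γ} (hTH : ∀ ρ ∈ T, ρ ∈ H)
    (hT : ∀ h ∈ H, ∃! t, t ∈ T ∧ h⁻¹ * t ∈ G)
    {φ : Γ → M} (hφ : ∀ s, ∀ g ∈ G, φ (s * g) = φ s) {σ : Γ} (hσ : σ ∈ H) :
    ∑ ρ ∈ T, φ (σ * ρ) = ∑ ρ ∈ T, φ ρ := by
  choose! c hc using fun h hh => (hT h hh).exists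
  have hmul : ∀ ρ ∈ T, σ * ρ ∈ H := fun ρ hρ => H.mul_mem hσ (hTH ρ hρ)
  refine Finset.sum_bij (fun ρ _ => c (σ * ρ)) (fun ρ hρ => (hc _ (hmul ρ hρ)).1) ?_ ?_ ?_
  · intro ρ₁ h₁ ρ₂ h₂ heq
    refine (hT ρ₁ (hTH ρ₁ h₁)).unique ⟨h₁, by simp⟩ ⟨h₂, ?_⟩
    have h := G.mul_mem (hc _ (hmul ρ₁ h₁)).2 (G.inv_mem (hc _ (hmul ρ₂ h₂)).2)
    rw [← show c (σ * ρ₁) = c (σ * ρ₂) from heq] at h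
    convert h using 1
    group
  · intro t ht
    obtain ⟨hρ, hG⟩ := hc (σ⁻¹ * t) (H.mul_mem (H.inv_mem hσ) (hTH t ht))
    refine ⟨c (σ⁻¹ * t), hρ, (hT _ (hmul _ hρ)).unique (hc _ (hmul _ hρ)) ⟨ht, ?_⟩⟩
    convert G.inv_mem hG using 1
    group
  · intro ρ hρ
    rw [← hφ (σ * ρ) _ (hc _ (hmul ρ hρ)).2, mul_inv_cancel_left]

theorem permHom_splittingMk (A : Type*) [CommRing A] (n : ℕ) (a : Fin n → A)
    (σ : Equiv.Perm (Fin n)) (p : MvPolynomial (Fin n) A) :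
    permHom A n a σ (splittingMk A n a p) = splittingMk A n a (rename (σ : Fin n → Fin n) p) :=
  rfl

/-- for subgroups `G ≤ H` of `S_n`, a trivial `G`-invariant `x` and a set `T ⊆ H`
of representatives of the left cosets of `G` in `H`, the sum `∑_{ρ ∈ T} ρ·x` is a trivial
`H`-invariant. -/
theorem coset_sum_trivialInv (A : Type*) [CommRing A] (n : ℕ) (hn : 1 ≤ n)
    (a : Fin n → A) (G H : Subgroup (Equiv.Perm (Fin n))) (hGH : G ≤ H)
    (x : SplittingAlg A n a) (hx : x ∈ trivialInv A n a G)
    (T : Finset (Equiv.Perm (Fin n))) (hTH : ∀ ρ ∈ T, ρ ∈ H)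
    (hT : ∀ h ∈ H, ∃! t, t ∈ T ∧ h⁻¹ * t ∈ G) :
    ∑ ρ ∈ T, permHom A n a ρ x ∈ trivialInv A n a H := by
  obtain ⟨p, hp, rfl⟩ := hx
  have hrename : ∀ s t : Equiv.Perm (Fin n),
      rename (⇑(s * t)) p = rename (s : Fin n → Fin n) (rename (t : Fin n → Fin n) p) :=
    fun s t => by rw [rename_rename, Equiv.Perm.coe_mul]
  refine ⟨∑ ρ ∈ T, rename (ρ : Fin n → Fin n) p, fun σ hσ => ?_, ?_⟩
  · rw [map_sum]
    simp only [← hrename]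
    exact sum_mul_left_eq_sum_of_transversal (φ := fun ρ => rename (ρ : Fin n → Fin n) p) hTH hT
      (fun s g hg => by rw [hrename, hp g hg]) hσ
  · simp only [map_sum, permHom_splittingMk]
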